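/- arXiv:1503.01139 — 2 statements merged into one kernel-verified Lean document; each statement's English description precedes it below -/
import Mathlib

section
/- Let (U, 𝒜, α) and (V, ℬ, β) be probability spaces, u, v : I → ℝ continuous injections, and H : U × V → I an (𝒜 ⊗ ℬ)-measurable function whose image H[U × V] is contained in a compact subset of I. For x ∈ U let H_x : V → ℝ, y ↦ H(x,y). Then the function K : U → ℝ, x ↦ M_β^v(H_x) is 𝒜-measurable with values in I and u ∘ K is α-integrable, and the (u,v)-mean of H relative to α ⊗ β satisfies H_{α,β}^{u,v}(H) = M_α^u(K), i.e. u⁻¹(∫_U u(v⁻¹(∫_V v ∘ H_x dβ)) dα(x)) = M_α^u(K). -/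
open MeasureTheory Set Function

/-- The mean of a measurable function with values in `[a, b]`, relative to a continuous `w`, is
attained by `w` on `[a, b]`. -/
theorem integral_comp_mem_image_Icc {S : Type*} [MeasurableSpace S] (γ : Measure S)
    [IsProbabilityMeasure γ] {a b : ℝ} {w : ℝ → ℝ} (hw : ContinuousOn w (Icc a b))
    {f : S → ℝ} (hfab : ∀ s, f s ∈ Icc a b) (hwf : Integrable (fun s => w (f s)) γ) :
    ∫ s, w (f s) ∂γ ∈ w '' Icc a b := by
  have hconv : Convex ℝ (w '' Icc a b) :=
    (isPreconnected_Icc.image w hw).ordConnected.convex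
  exact hconv.integral_mem (isCompact_Icc.image_of_continuousOn hw).isClosed
    (Filter.Eventually.of_forall fun s => mem_image_of_mem w (hfab s)) hwf

theorem measurable_comp_of_continuousOn_Icc {S : Type*} [MeasurableSpace S] {a b : ℝ}
    (hab : a ≤ b) {w : ℝ → ℝ} (hw : ContinuousOn w (Icc a b)) {f : S → ℝ} (hf : Measurable f)
    (hfab : ∀ s, f s ∈ Icc a b) : Measurable fun s => w (f s) := by
  have hext : Continuous (IccExtend hab ((Icc a b).domRestrict w)) := hw.domRestrict.Icc_extend'
  convert hext.measurable.comp hf using 1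
  ext s
  simp [IccExtend_of_mem hab _ (hfab s)]

theorem integrable_comp_of_continuousOn_Icc {S : Type*} [MeasurableSpace S] (γ : Measure S)
    [IsFiniteMeasure γ] {a b : ℝ} {w : ℝ → ℝ} (hw : ContinuousOn w (Icc a b))
    {f : S → ℝ} (hfab : ∀ s, f s ∈ Icc a b) (hwf : Measurable fun s => w (f s)) :
    Integrable (fun s => w (f s)) γ := by
  obtain ⟨C, hC⟩ := isCompact_Icc.exists_bound_of_continuousOn hw
  exact Integrable.of_bound hwf.aestronglyMeasurable C
    (Filter.Eventually.of_forall fun s => hC _ (hfab s))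

/-- A function with values in `[a, b]` is measurable as soon as its composition with some
continuous injection on `[a, b]` is. -/
theorem measurable_of_comp_continuousOn_injOn_Icc {S : Type*} [MeasurableSpace S] {a b : ℝ}
    {w : ℝ → ℝ} (hw : ContinuousOn w (Icc a b)) (hwi : InjOn w (Icc a b)) {f : S → ℝ}
    (hfab : ∀ s, f s ∈ Icc a b) (hwf : Measurable fun s => w (f s)) : Measurable f := by
  have hemb : MeasurableEmbedding ((Icc a b).domRestrict w) :=
    (hw.domRestrict.isClosedEmbedding hwi.injective).measurableEmbedding
  have hcod : Measurable fun s => (⟨f s, hfab s⟩ : Icc a b) :=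
    hemb.measurable_comp_iff.mp hwf
  exact measurable_subtype_coe.comp hcod

/-- **Remark (factorization of the double mean).** Let `(U, 𝒜, α)` and `(V, ℬ, β)` be
probability spaces, `u, v : I → ℝ` continuous injections, and `H : U × V → I` an
`(𝒜 ⊗ ℬ)`-measurable function whose image is contained in a compact subset of `I`.
Then the function `K : U → ℝ, x ↦ M_β^v(H_x)` is `𝒜`-measurable with values in `I`,
`u ∘ K` is `α`-integrable, and `H_{α,β}^{u,v}(H) = M_α^u(K)`. -/
theorem double_mean_factorization
    {U V : Type*} [MeasurableSpace U] [MeasurableSpace V]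
    (α : Measure U) (β : Measure V) [IsProbabilityMeasure α] [IsProbabilityMeasure β]
    (I : Set ℝ) (hI : I.Nonempty) (hIconn : I.OrdConnected)
    (u : ℝ → ℝ) (huc : ContinuousOn u I) (hui : Set.InjOn u I)
    (v : ℝ → ℝ) (hvc : ContinuousOn v I) (hvi : Set.InjOn v I)
    (H : U × V → ℝ) (hHmeas : Measurable H)
    (hHK : ∃ K : Set ℝ, IsCompact K ∧ K ⊆ I ∧ Set.range H ⊆ K)
    (K : U → ℝ) (hK : ∀ x, K x = Function.invFunOn v I (∫ y, v (H (x, y)) ∂β)) :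
    Measurable K ∧ (∀ x, K x ∈ I) ∧ Integrable (fun x => u (K x)) α ∧
      Function.invFunOn u I
          (∫ x, u (Function.invFunOn v I (∫ y, v (H (x, y)) ∂β)) ∂α)
        = Function.invFunOn u I (∫ x, u (K x) ∂α) := by
  obtain ⟨C, hC, hCI, hHC⟩ := hHK
  have hU : Nonempty U := nonempty_of_isProbabilityMeasure α
  have hV : Nonempty V := nonempty_of_isProbabilityMeasure β
  have hCne : C.Nonempty := (range_nonempty H).mono hHC
  obtain ⟨a, ha⟩ := hC.exists_isLeast hCne
  obtain ⟨b, hb⟩ := hC.exists_isGreatest hCne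
  have hab : a ≤ b := ha.2 hb.1
  have hsub : Icc a b ⊆ I := hIconn.out (hCI ha.1) (hCI hb.1)
  have hHab : ∀ p, H p ∈ Icc a b := fun p =>
    ⟨ha.2 (hHC (mem_range_self p)), hb.2 (hHC (mem_range_self p))⟩
  have hvab := hvc.mono hsub
  have huab := huc.mono hsub
  have hvH : Measurable fun p => v (H p) :=
    measurable_comp_of_continuousOn_Icc hab hvab hHmeas hHab
  have hmem : ∀ x, ∫ y, v (H (x, y)) ∂β ∈ v '' Icc a b := fun x =>
    integral_comp_mem_image_Icc β hvab (fun y => hHab (x, y))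
      (integrable_comp_of_continuousOn_Icc β hvab (fun y => hHab (x, y))
        (hvH.comp measurable_prodMk_left))
  have hKspec : ∀ x, K x ∈ Icc a b ∧ v (K x) = ∫ y, v (H (x, y)) ∂β := by
    intro x
    obtain ⟨t, ht, htx⟩ := hmem x
    have hKt : K x = t := by
      rw [hK x, ← htx]
      exact hvi.leftInvOn_invFunOn (hsub ht)
    exact hKt ▸ ⟨ht, htx⟩
  have hKab : ∀ x, K x ∈ Icc a b := fun x => (hKspec x).1
  have hvK : Measurable fun x => v (K x) := by
    simp only [fun x => (hKspec x).2]
    exact hvH.stronglyMeasurable.integral_prod_right'.measurable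
  have hKm : Measurable K :=
    measurable_of_comp_continuousOn_injOn_Icc hvab (hvi.mono hsub) hKab hvK
  refine ⟨hKm, fun x => hsub (hKab x), ?_, by simp only [hK]⟩
  exact integrable_comp_of_continuousOn_Icc α huab hKab
    (measurable_comp_of_continuousOn_Icc hab huab hKm hKab)
end

section
/- Let (X, ℒ, λ) and (Y, ℳ, μ) be probability spaces with λ and μ non-degenerate, and let f, g : I → ℝ be continuous injections. Then (f, g) is a (λ, μ)-switch if and only if there exist a, b ∈ ℝ with a ≠ 0 such that f = a·g + b. -/
open MeasureTheory Set Function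

/-- For probability spaces `(X, ℒ, λ)` and `(Y, ℳ, μ)` and functions `f, g : ℝ → ℝ`
(thought of as continuous injections on the interval `I`), the pair `(f, g)` is a
`(λ, μ)`-switch if for every `(ℒ ⊗ ℳ)`-measurable `h : X × Y → I` whose image is
contained in a compact subset of `I`, it holds that
`f⁻¹(∫_X f(g⁻¹(∫_Y g(h(x,y)) dμ(y))) dλ(x)) = g⁻¹(∫_Y g(f⁻¹(∫_X f(h(x,y)) dλ(x))) dμ(y))`,
where `f⁻¹` — the inverse of the corestriction of `f` to `f[I]` — is rendered as
`Function.invFunOn f I`, and similarly for `g⁻¹`. -/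
def IsSwitch {X Y : Type*} [MeasurableSpace X] [MeasurableSpace Y]
    (lam : Measure X) (mu : Measure Y) (I : Set ℝ) (f g : ℝ → ℝ) : Prop :=
  ∀ h : X × Y → ℝ, Measurable h →
    (∃ K : Set ℝ, IsCompact K ∧ K ⊆ I ∧ Set.range h ⊆ K) →
    Function.invFunOn f I
        (∫ x, f (Function.invFunOn g I (∫ y, g (h (x, y)) ∂mu)) ∂lam)
      = Function.invFunOn g I
          (∫ y, g (Function.invFunOn f I (∫ x, f (h (x, y)) ∂lam)) ∂mu)

/-- The mean of a function taking one value on `E` and another one off `E`. -/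
lemma integral_ite_mem_const {Z : Type*} [MeasurableSpace Z] (ν : Measure Z)
    [IsProbabilityMeasure ν] {E : Set Z} (hE : MeasurableSet E) [DecidablePred (· ∈ E)]
    (r s : ℝ) :
    ∫ x, (if x ∈ E then r else s) ∂ν = ν.real E * r + (1 - ν.real E) * s := by
  have hfun : (fun x => if x ∈ E then r else s) =
      fun x => E.indicator (fun _ => r - s) x + s := by
    funext x
    by_cases hx : x ∈ E <;> simp [hx]
  rw [hfun, integral_add ((integrable_const _).indicator hE) (integrable_const _),
    integral_indicator_const _ hE]
  simp
  ring

/-- A maximum principle for continuous functions that are convex with respect to one weight. -/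
lemma nonpos_of_weighted_convex {d : ℝ → ℝ} {θ : ℝ} (h0 : 0 < θ) (h1 : θ < 1)
    (hc : ContinuousOn d (Icc 0 1)) (hd0 : d 0 ≤ 0) (hd1 : d 1 ≤ 0)
    (hd : ∀ s ∈ Icc (0 : ℝ) 1, ∀ t ∈ Icc (0 : ℝ) 1,
      d (θ * s + (1 - θ) * t) ≤ θ * d s + (1 - θ) * d t) :
    ∀ t ∈ Icc (0 : ℝ) 1, d t ≤ 0 := by
  by_contra! hneg
  obtain ⟨t₀, ht₀, hpos⟩ := hneg
  obtain ⟨t₁, ht₁, hmax⟩ := isCompact_Icc.exists_isMaxOn ⟨t₀, ht₀⟩ hc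
  have hle : ∀ t ∈ Icc (0 : ℝ) 1, d t ≤ d t₁ := fun t ht => hmax ht
  have hM : 0 < d t₁ := hpos.trans_le (hle t₀ ht₀)
  have hS : IsCompact (Icc (0 : ℝ) 1 ∩ d ⁻¹' {d t₁}) :=
    isCompact_Icc.of_isClosed_subset
      (hc.preimage_isClosed_of_isClosed isClosed_Icc isClosed_singleton) inter_subset_left
  obtain ⟨t, ⟨ht, htM⟩, hleast⟩ := hS.exists_isLeast ⟨t₁, ht₁, rfl⟩
  have htM : d t = d t₁ := htM
  have ht0 : 0 < t := lt_of_le_of_ne ht.1 (by rintro rfl; linarith)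
  have ht1 : t < 1 := lt_of_le_of_ne ht.2 (by rintro rfl; linarith)
  obtain ⟨ε, hε, hεl, hεr⟩ : ∃ ε > 0, ε ≤ t ∧ ε ≤ 1 - t :=
    ⟨min t (1 - t), lt_min ht0 (by linarith), min_le_left _ _, min_le_right _ _⟩
  have hl : t - (1 - θ) * ε ∈ Icc (0 : ℝ) 1 := ⟨by nlinarith, by nlinarith⟩
  have hr : t + θ * ε ∈ Icc (0 : ℝ) 1 := ⟨by nlinarith, by nlinarith⟩
  have hmid := hd _ hl _ hr
  rw [show θ * (t - (1 - θ) * ε) + (1 - θ) * (t + θ * ε) = t by ring, htM] at hmid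
  have hlt : d (t - (1 - θ) * ε) < d t₁ := by
    refine lt_of_le_of_ne (hle _ hl) fun heq => ?_
    have := hleast ⟨hl, heq⟩
    nlinarith
  nlinarith [hle _ hr]

/-- A continuous function on `[0, 1]` that is affine with respect to one weight is affine. -/
lemma eq_affine_of_weighted_affine {ψ : ℝ → ℝ} {θ : ℝ} (h0 : 0 < θ) (h1 : θ < 1)
    (hc : ContinuousOn ψ (Icc 0 1))
    (hψ : ∀ s ∈ Icc (0 : ℝ) 1, ∀ t ∈ Icc (0 : ℝ) 1,
      ψ (θ * s + (1 - θ) * t) = θ * ψ s + (1 - θ) * ψ t)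
    {t : ℝ} (ht : t ∈ Icc (0 : ℝ) 1) : ψ t = (1 - t) * ψ 0 + t * ψ 1 := by
  have hle := nonpos_of_weighted_convex (d := fun t => ψ t - ((1 - t) * ψ 0 + t * ψ 1)) h0 h1
    (by fun_prop) (by simp) (by simp)
    (fun s hs t ht => le_of_eq (by simp only [hψ s hs t ht]; ring)) t ht
  have hge := nonpos_of_weighted_convex (d := fun t => (1 - t) * ψ 0 + t * ψ 1 - ψ t) h0 h1
    (by fun_prop) (by simp) (by simp)
    (fun s hs t ht => le_of_eq (by simp only [hψ s hs t ht]; ring)) t ht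
  linarith

/-- A map into a compact set is continuous if its composition with a continuous injection is. -/
lemma continuousOn_of_comp_injOn {φ M : ℝ → ℝ} {K S : Set ℝ} (hK : IsCompact K)
    (hφ : ContinuousOn φ K) (hinj : InjOn φ K) (hM : MapsTo M S K)
    (hc : ContinuousOn (fun t => φ (M t)) S) : ContinuousOn M S := by
  have : CompactSpace K := isCompact_iff_compactSpace.mp hK
  have hemb : Topology.IsClosedEmbedding (K.domRestrict φ) :=
    Continuous.isClosedEmbedding (continuousOn_iff_continuous_domRestrict.mp hφ)
      (injOn_iff_injective.mp hinj)
  rw [continuousOn_iff_continuous_domRestrict] at hc ⊢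
  have hcont : Continuous (fun t : S => (⟨M t, hM t.2⟩ : K)) := hemb.continuous_iff.mpr hc
  exact continuous_subtype_val.comp hcont

/-- The image of an interval under a continuous function is convex. -/
lemma convex_image_of_continuousOn {φ : ℝ → ℝ} {J : Set ℝ} (hJ : Convex ℝ J)
    (hφ : ContinuousOn φ J) : Convex ℝ (φ '' J) :=
  (hJ.isPreconnected.image φ hφ).ordConnected.convex

/-- If a weighted quasi-arithmetic mean is affine with respect to some weight, then its generator
is affine. -/
lemma generator_affine {φ : ℝ → ℝ} {m : ℝ → ℝ → ℝ} {J : Set ℝ} {p q : ℝ}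
    (hJ : Convex ℝ J) (hp0 : 0 < p) (hp1 : p < 1) (hq0 : 0 < q) (hq1 : q < 1)
    (hφ : ContinuousOn φ J) (hinj : InjOn φ J) (hJc : IsCompact J)
    (hmJ : ∀ u ∈ J, ∀ v ∈ J, m u v ∈ J)
    (hm : ∀ u ∈ J, ∀ v ∈ J, φ (m u v) = p * φ u + (1 - p) * φ v)
    (hq : ∀ u₁ ∈ J, ∀ u₂ ∈ J, ∀ u₃ ∈ J, ∀ u₄ ∈ J,
      m (q * u₁ + (1 - q) * u₂) (q * u₃ + (1 - q) * u₄) = q * m u₁ u₃ + (1 - q) * m u₂ u₄)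
    {x y : ℝ} (hx : x ∈ J) (hy : y ∈ J) {t : ℝ} (ht : t ∈ Icc (0 : ℝ) 1) :
    φ ((1 - t) * x + t * y) = (1 - t) * φ x + t * φ y := by
  have comb : ∀ {t : ℝ}, t ∈ Icc (0 : ℝ) 1 → ∀ {u v : ℝ}, u ∈ J → v ∈ J →
      (1 - t) * u + t * v ∈ J := fun ht u v hu hv =>
    hJ hu hv (by linarith [ht.2]) ht.1 (by ring)
  have aff : ∀ u₀ ∈ J, ∀ u₁ ∈ J, ∀ v₀ ∈ J, ∀ v₁ ∈ J, ∀ t ∈ Icc (0 : ℝ) 1,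
      m ((1 - t) * u₀ + t * u₁) ((1 - t) * v₀ + t * v₁) =
        (1 - t) * m u₀ v₀ + t * m u₁ v₁ := by
    intro u₀ hu₀ u₁ hu₁ v₀ hv₀ v₁ hv₁ t ht
    have hu : MapsTo (fun t : ℝ => (1 - t) * u₀ + t * u₁) (Icc 0 1) J :=
      fun t ht => comb ht hu₀ hu₁
    have hv : MapsTo (fun t : ℝ => (1 - t) * v₀ + t * v₁) (Icc 0 1) J :=
      fun t ht => comb ht hv₀ hv₁
    have hcont : ContinuousOn
        (fun t : ℝ => m ((1 - t) * u₀ + t * u₁) ((1 - t) * v₀ + t * v₁)) (Icc 0 1) := by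
      refine continuousOn_of_comp_injOn hJc hφ hinj
        (fun t ht => hmJ _ (hu ht) _ (hv ht)) ?_
      refine ContinuousOn.congr (f := fun t : ℝ => p * φ ((1 - t) * u₀ + t * u₁) +
        (1 - p) * φ ((1 - t) * v₀ + t * v₁)) ?_ (fun t ht => hm _ (hu ht) _ (hv ht))
      have hcu := hφ.comp (by fun_prop) hu
      have hcv := hφ.comp (by fun_prop) hv
      exact (continuousOn_const.mul hcu).add (continuousOn_const.mul hcv)
    have := eq_affine_of_weighted_affine hq0 hq1 hcont (fun s hs t ht => by
      rw [← hq _ (hu hs) _ (hu ht) _ (hv hs) _ (hv ht)]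
      congr 1 <;> ring) ht
    simpa using this
  have diag : ∀ u ∈ J, m u u = u := fun u hu =>
    hinj (hmJ u hu u hu) hu (by rw [hm u hu u hu]; ring)
  have half : (1 / 2 : ℝ) ∈ Icc (0 : ℝ) 1 := by constructor <;> norm_num
  have midpoint : ∀ x ∈ J, ∀ y ∈ J,
      φ ((1 - 1 / 2) * x + 1 / 2 * y) = (1 - 1 / 2) * φ x + 1 / 2 * φ y := by
    intro x hx y hy
    have hseg : Convex ℝ (segment ℝ x y) := convex_segment x y
    have hsub : segment ℝ x y ⊆ J := hJ.segment_subset hx hy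
    obtain ⟨z, hz, hzφ⟩ : p * φ x + (1 - p) * φ y ∈ φ '' segment ℝ x y :=
      convex_image_of_continuousOn hseg (hφ.mono hsub)
        (mem_image_of_mem φ (left_mem_segment ℝ x y))
        (mem_image_of_mem φ (right_mem_segment ℝ x y)) hp0.le (by linarith) (by ring)
    have hmz : m x y = z := hinj (hmJ x hx y hy) (hsub hz) (by rw [hm x hx y hy, hzφ])
    obtain ⟨α, β, hα, hβ, hαβ, hcomb⟩ := hz
    obtain rfl : α = 1 - β := by linarith
    have hβ' : β ∈ Icc (0 : ℝ) 1 := ⟨hβ, by linarith⟩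
    have hxy : m x y = (1 - β) * x + β * y := by rw [hmz, ← hcomb]; simp
    set c := (1 - 1 / 2) * x + 1 / 2 * y with hc
    have hcJ : c ∈ J := comb half hx hy
    have hyx : m y x = β * x + (1 - β) * y := by
      have h := aff x hx y hy y hy x hx _ half
      rw [show (1 - 1 / 2) * y + 1 / 2 * x = c by rw [hc]; ring, ← hc, diag c hcJ, hxy] at h
      rw [hc] at h
      linarith
    have hcx := aff x hx y hy x hx x hx _ half
    have hyc := aff y hy y hy x hx y hy _ half
    have hcy := aff x hx y hy y hy y hy _ half
    have hxc := aff x hx x hx x hx y hy _ half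
    rw [← hc, show (1 - 1 / 2) * x + 1 / 2 * x = x by ring, diag x hx] at hcx hxc
    rw [← hc, show (1 - 1 / 2) * y + 1 / 2 * y = y by ring, diag y hy] at hyc hcy
    have hout := aff c hcJ x hx y hy c hcJ β hβ'
    have hl : (1 - β) * c + β * x = m c x := by rw [hcx, hyx, hc]; ring
    have hr : (1 - β) * y + β * c = m y c := by rw [hyc, hyx, hc]; ring
    have hfix : m (m c x) (m y c) = c := by
      rw [← hl, ← hr, hout, hcy, hxc, hxy, hc]; ring
    have key := hm _ (hmJ c hcJ x hx) _ (hmJ y hy c hcJ)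
    rw [hfix, hm c hcJ x hx, hm y hy c hcJ] at key
    have hpp : 2 * p * (1 - p) ≠ 0 := by
      have : 0 < 1 - p := by linarith
      positivity
    refine mul_left_cancel₀ hpp ?_
    linarith
  have hcont : ContinuousOn (fun t : ℝ => φ ((1 - t) * x + t * y)) (Icc 0 1) :=
    hφ.comp (by fun_prop) (fun t ht => comb ht hx hy)
  have := eq_affine_of_weighted_affine (θ := 1 / 2) (by norm_num) (by norm_num) hcont
    (fun s hs t ht => by
      have h := midpoint _ (comb hs hx hy) _ (comb ht hx hy)
      rw [show (1 - (1 / 2 * s + (1 - 1 / 2) * t)) * x + (1 / 2 * s + (1 - 1 / 2) * t) * y =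
        (1 - 1 / 2) * ((1 - s) * x + s * y) + 1 / 2 * ((1 - t) * x + t * y) by ring, h]
      ring) ht
  simpa using this

/-- A switch applied to a function which is constant on each of the four rectangles determined by
`E` and `F`. -/
lemma IsSwitch.four_points {X Y : Type*} [MeasurableSpace X] [MeasurableSpace Y]
    {lam : Measure X} {mu : Measure Y} [IsProbabilityMeasure lam] [IsProbabilityMeasure mu]
    {E : Set X} {F : Set Y} (hE : MeasurableSet E) (hF : MeasurableSet F)
    {I K : Set ℝ} {f g : ℝ → ℝ} (hKI : K ⊆ I) (hK : Convex ℝ K)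
    (hfc : ContinuousOn f K) (hfi : InjOn f I)
    (hgc : ContinuousOn g K) (hgi : InjOn g I) (hsw : IsSwitch lam mu I f g)
    {a b c d s s' r r' : ℝ} (ha : a ∈ K) (hb : b ∈ K) (hc : c ∈ K) (hd : d ∈ K)
    (hs : s ∈ K) (hs' : s' ∈ K) (hr : r ∈ K) (hr' : r' ∈ K)
    (hgs : g s = mu.real F * g a + (1 - mu.real F) * g b)
    (hgs' : g s' = mu.real F * g c + (1 - mu.real F) * g d)
    (hfr : f r = lam.real E * f a + (1 - lam.real E) * f c)
    (hfr' : f r' = lam.real E * f b + (1 - lam.real E) * f d) :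
    ∃ z ∈ K, f z = lam.real E * f s + (1 - lam.real E) * f s' ∧
      g z = mu.real F * g r + (1 - mu.real F) * g r' := by
  classical
  have inv : ∀ {k : ℝ → ℝ}, InjOn k I → ∀ {x}, x ∈ K → invFunOn k I (k x) = x :=
    fun hk _ hx => hk.leftInvOn_invFunOn (hKI hx)
  have h := hsw (fun w => if w.1 ∈ E then (if w.2 ∈ F then a else b)
      else (if w.2 ∈ F then c else d))
    (Measurable.ite (measurable_fst hE)
      (Measurable.ite (measurable_snd hF) measurable_const measurable_const)
      (Measurable.ite (measurable_snd hF) measurable_const measurable_const))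
    ⟨{a, b, c, d}, (Set.toFinite _).isCompact, by
      intro x hx
      rcases hx with rfl | rfl | rfl | rfl
      exacts [hKI ha, hKI hb, hKI hc, hKI hd], by
      rintro _ ⟨w, rfl⟩
      dsimp only
      split_ifs <;> simp⟩
  have hin : ∀ x, invFunOn g I (∫ y, g (if x ∈ E then (if y ∈ F then a else b)
      else (if y ∈ F then c else d)) ∂mu) = if x ∈ E then s else s' := by
    intro x
    by_cases hx : x ∈ E
    · simp only [hx, if_true, apply_ite g]
      rw [integral_ite_mem_const mu hF, ← hgs, inv hgi hs]
    · simp only [hx, if_false, apply_ite g]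
      rw [integral_ite_mem_const mu hF, ← hgs', inv hgi hs']
  have hin' : ∀ y, invFunOn f I (∫ x, f (if x ∈ E then (if y ∈ F then a else b)
      else (if y ∈ F then c else d)) ∂lam) = if y ∈ F then r else r' := by
    intro y
    by_cases hy : y ∈ F
    · simp only [hy, if_true, apply_ite f]
      rw [integral_ite_mem_const lam hE, ← hfr, inv hfi hr]
    · simp only [hy, if_false, apply_ite f]
      rw [integral_ite_mem_const lam hE, ← hfr', inv hfi hr']
  simp only [hin, hin'] at h
  simp only [apply_ite f, apply_ite g] at h
  rw [integral_ite_mem_const lam hE, integral_ite_mem_const mu hF] at h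
  obtain ⟨z, hz, hfz⟩ : lam.real E * f s + (1 - lam.real E) * f s' ∈ f '' K :=
    convex_image_of_continuousOn hK hfc (mem_image_of_mem f hs) (mem_image_of_mem f hs')
      measureReal_nonneg (sub_nonneg.mpr measureReal_le_one) (by ring)
  obtain ⟨z', hz', hgz'⟩ : mu.real F * g r + (1 - mu.real F) * g r' ∈ g '' K :=
    convex_image_of_continuousOn hK hgc (mem_image_of_mem g hr) (mem_image_of_mem g hr')
      measureReal_nonneg (sub_nonneg.mpr measureReal_le_one) (by ring)
  rw [← hfz, ← hgz', inv hfi hz, inv hgi hz'] at h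
  exact ⟨z, hz, hfz, by rw [h, hgz']⟩

/-- The two functions of a switch are affinely related at any three points. -/
lemma IsSwitch.collinear {X Y : Type*} [MeasurableSpace X] [MeasurableSpace Y]
    {lam : Measure X} {mu : Measure Y} [IsProbabilityMeasure lam] [IsProbabilityMeasure mu]
    {E : Set X} {F : Set Y} (hE : MeasurableSet E) (hF : MeasurableSet F)
    (hE0 : 0 < lam.real E) (hE1 : lam.real E < 1) (hF0 : 0 < mu.real F) (hF1 : mu.real F < 1)
    {I : Set ℝ} {f g : ℝ → ℝ} (hI : I.OrdConnected)
    (hfc : ContinuousOn f I) (hfi : InjOn f I)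
    (hgc : ContinuousOn g I) (hgi : InjOn g I) (hsw : IsSwitch lam mu I f g)
    {A B x : ℝ} (hA : A ∈ I) (hB : B ∈ I) (hAx : A ≤ x) (hxB : x ≤ B) :
    (f x - f A) * (g B - g A) = (g x - g A) * (f B - f A) := by
  set K := Icc A B
  have hKI : K ⊆ I := hI.out hA hB
  have hKc : IsCompact K := isCompact_Icc
  have hKx : Convex ℝ K := convex_Icc A B
  replace hfc := hfc.mono hKI
  replace hgc := hgc.mono hKI
  have hfK := hfi.mono hKI
  have hgK := hgi.mono hKI
  have hJ : Convex ℝ (g '' K) := convex_image_of_continuousOn hKx hgc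
  have hJc : IsCompact (g '' K) := hKc.image_of_continuousOn hgc
  set k := invFunOn g K
  have hkK : ∀ u ∈ g '' K, k u ∈ K := fun u hu => invFunOn_mem hu
  have hgk : ∀ u ∈ g '' K, g (k u) = u := fun u hu => invFunOn_eq hu
  have hkg : ∀ a ∈ K, k (g a) = a := fun a ha => hgK.leftInvOn_invFunOn ha
  have hkc : ContinuousOn k (g '' K) :=
    continuousOn_of_comp_injOn hKc hgc hgK hkK (continuousOn_id.congr hgk)
  have hφ : ContinuousOn (fun u => f (k u)) (g '' K) := hfc.comp hkc hkK
  have hinj : InjOn (fun u => f (k u)) (g '' K) := fun u hu v hv huv => by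
    rw [← hgk u hu, ← hgk v hv, hfK (hkK u hu) (hkK v hv) huv]
  have hex : ∀ u v : ℝ, ∃ w, u ∈ g '' K → v ∈ g '' K →
      w ∈ g '' K ∧ f (k w) = lam.real E * f (k u) + (1 - lam.real E) * f (k v) := by
    intro u v
    by_cases huv : u ∈ g '' K ∧ v ∈ g '' K
    · obtain ⟨w, hw, hfw⟩ := convex_image_of_continuousOn hJ hφ
        (mem_image_of_mem _ huv.1) (mem_image_of_mem _ huv.2) hE0.le
        (sub_nonneg.mpr hE1.le) (by ring)
      exact ⟨w, fun _ _ => ⟨hw, hfw⟩⟩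
    · exact ⟨0, fun hu hv => absurd ⟨hu, hv⟩ huv⟩
  choose m hm using hex
  have hmJ : ∀ u ∈ g '' K, ∀ v ∈ g '' K, m u v ∈ g '' K := fun u hu v hv => (hm u v hu hv).1
  have hmf : ∀ u ∈ g '' K, ∀ v ∈ g '' K,
      f (k (m u v)) = lam.real E * f (k u) + (1 - lam.real E) * f (k v) :=
    fun u hu v hv => (hm u v hu hv).2
  have hcomb : ∀ u ∈ g '' K, ∀ v ∈ g '' K,
      mu.real F * u + (1 - mu.real F) * v ∈ g '' K := fun u hu v hv =>
    hJ hu hv hF0.le (sub_nonneg.mpr hF1.le) (by ring)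
  have hq : ∀ u₁ ∈ g '' K, ∀ u₂ ∈ g '' K, ∀ u₃ ∈ g '' K, ∀ u₄ ∈ g '' K,
      m (mu.real F * u₁ + (1 - mu.real F) * u₂) (mu.real F * u₃ + (1 - mu.real F) * u₄) =
        mu.real F * m u₁ u₃ + (1 - mu.real F) * m u₂ u₄ := by
    intro u₁ h₁ u₂ h₂ u₃ h₃ u₄ h₄
    have h₁₂ := hcomb _ h₁ _ h₂
    have h₃₄ := hcomb _ h₃ _ h₄
    have h₁₃ := hmJ _ h₁ _ h₃
    have h₂₄ := hmJ _ h₂ _ h₄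
    obtain ⟨z, hz, hfz, hgz⟩ := hsw.four_points hE hF hKI hKx hfc hfi hgc hgi
      (hkK _ h₁) (hkK _ h₂) (hkK _ h₃) (hkK _ h₄)
      (hkK _ h₁₂) (hkK _ h₃₄) (hkK _ h₁₃) (hkK _ h₂₄)
      (by rw [hgk _ h₁₂, hgk _ h₁, hgk _ h₂]) (by rw [hgk _ h₃₄, hgk _ h₃, hgk _ h₄])
      (hmf _ h₁ _ h₃) (hmf _ h₂ _ h₄)
    rw [hgk _ h₁₃, hgk _ h₂₄] at hgz
    rw [← hgz]
    refine hinj (hmJ _ h₁₂ _ h₃₄) (mem_image_of_mem g hz) ?_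
    simp only [hmf _ h₁₂ _ h₃₄, hkg z hz, hfz]
  have hAB : A ≤ B := hAx.trans hxB
  have hAK : A ∈ K := left_mem_Icc.mpr hAB
  have hBK : B ∈ K := right_mem_Icc.mpr hAB
  have hxK : x ∈ K := ⟨hAx, hxB⟩
  have hgx : g x ∈ segment ℝ (g A) (g B) := by
    have hsub : g '' K ⊇ segment ℝ (g A) (g B) :=
      hJ.segment_subset (mem_image_of_mem g hAK) (mem_image_of_mem g hBK)
    rw [segment_eq_uIcc]
    rcases hgc.strictMonoOn_of_injOn_Icc' hAB hgK with hmono | hanti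
    · exact Icc_subset_uIcc ⟨hmono.monotoneOn hAK hxK hAx, hmono.monotoneOn hxK hBK hxB⟩
    · exact Icc_subset_uIcc' ⟨hanti.antitoneOn hxK hBK hxB, hanti.antitoneOn hAK hxK hAx⟩
  obtain ⟨α, t, hα, ht, hαt, hgt⟩ := hgx
  obtain rfl : α = 1 - t := by linarith
  have hfin := generator_affine hJ hE0 hE1 hF0 hF1 hφ hinj hJc hmJ hmf hq
    (mem_image_of_mem g hAK) (mem_image_of_mem g hBK) (t := t) ⟨ht, by linarith⟩
  simp only [smul_eq_mul] at hgt
  simp only [hgt, hkg _ hAK, hkg _ hBK, hkg _ hxK] at hfin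
  rw [hfin, ← hgt]
  ring

/-- A measurable function with values in a compact convex set of reals is integrable with respect
to a probability measure, and its mean lies in that set. -/
lemma integrable_and_integral_mem {Z : Type*} [MeasurableSpace Z] (ν : Measure Z)
    [IsProbabilityMeasure ν] {G : Set ℝ} (hG : Convex ℝ G) (hGc : IsCompact G) {u : Z → ℝ}
    (hu : StronglyMeasurable u) (huG : ∀ z, u z ∈ G) :
    Integrable u ν ∧ ∫ z, u z ∂ν ∈ G := by
  obtain ⟨C, hC⟩ := hGc.isBounded.exists_norm_le
  have hint : Integrable u ν := Integrable.of_bound hu.aestronglyMeasurable C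
    (Filter.Eventually.of_forall fun z => hC _ (huG z))
  exact ⟨hint, hG.integral_mem hGc.isClosed (Filter.Eventually.of_forall huG) hint⟩

/-- Affinely related functions form a switch. -/
lemma isSwitch_of_affine {X Y : Type*} [MeasurableSpace X] [MeasurableSpace Y]
    (lam : Measure X) (mu : Measure Y)
    [IsProbabilityMeasure lam] [IsProbabilityMeasure mu]
    {I : Set ℝ} (hI : I.OrdConnected) {f g : ℝ → ℝ}
    (hgc : ContinuousOn g I) (hfi : InjOn f I) {a b : ℝ}
    (hfg : ∀ x ∈ I, f x = a * g x + b) : IsSwitch lam mu I f g := by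
  rintro h hh ⟨L, hL, hLI, hrange⟩
  have hmemL : ∀ w, h w ∈ L := fun w => hrange (mem_range_self w)
  obtain ⟨x₀⟩ : Nonempty X := nonempty_of_isProbabilityMeasure lam
  obtain ⟨y₀⟩ : Nonempty Y := nonempty_of_isProbabilityMeasure mu
  obtain ⟨A, hAL, hA⟩ := hL.exists_isLeast ⟨_, hmemL (x₀, y₀)⟩
  obtain ⟨B, hBL, hB⟩ := hL.exists_isGreatest ⟨_, hmemL (x₀, y₀)⟩
  have hKI : Icc A B ⊆ I := hI.out (hLI hAL) (hLI hBL)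
  have hmem : ∀ w, h w ∈ Icc A B := fun w => ⟨hA (hmemL w), hB (hmemL w)⟩
  have hgK := hgc.mono hKI
  have hG : Convex ℝ (g '' Icc A B) := convex_image_of_continuousOn (convex_Icc A B) hgK
  have hGc : IsCompact (g '' Icc A B) := isCompact_Icc.image_of_continuousOn hgK
  have hghm : ∀ w, g (h w) ∈ g '' Icc A B := fun w => mem_image_of_mem g (hmem w)
  have hgh : Measurable fun w => g (h w) :=
    (continuousOn_iff_continuous_domRestrict.mp hgK).measurable.comp (hh.subtype_mk (h := hmem))
  have hsec : ∀ x, ∫ y, g (h (x, y)) ∂mu ∈ g '' Icc A B := fun x =>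
    (integrable_and_integral_mem mu hG hGc
      (hgh.comp measurable_prodMk_left).stronglyMeasurable fun y => hghm (x, y)).2
  have hsec' : ∀ y, ∫ x, g (h (x, y)) ∂lam ∈ g '' Icc A B := fun y =>
    (integrable_and_integral_mem lam hG hGc
      (hgh.comp measurable_prodMk_right).stronglyMeasurable fun x => hghm (x, y)).2
  have hout := integrable_and_integral_mem lam hG hGc
    hgh.stronglyMeasurable.integral_prod_right' hsec
  have hprod := (integrable_and_integral_mem (lam.prod mu) hG hGc hgh.stronglyMeasurable hghm).1
  have hginv : ∀ u ∈ g '' Icc A B, g (invFunOn g I u) = u := fun u hu =>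
    invFunOn_eq (image_mono hKI hu)
  have hfg' : ∀ u ∈ g '' Icc A B, f (invFunOn g I u) = a * u + b := fun u hu => by
    rw [hfg _ (invFunOn_mem (image_mono hKI hu)), hginv u hu]
  have hfinv : ∀ u ∈ g '' Icc A B, invFunOn f I (a * u + b) = invFunOn g I u := fun u hu => by
    rw [← hfg' u hu, hfi.leftInvOn_invFunOn (invFunOn_mem (image_mono hKI hu))]
  have hfint : ∀ y, ∫ x, f (h (x, y)) ∂lam = a * ∫ x, g (h (x, y)) ∂lam + b := fun y => by
    have hi : Integrable (fun x => g (h (x, y))) lam := (integrable_and_integral_mem lam hG hGc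
      (hgh.comp measurable_prodMk_right).stronglyMeasurable fun x => hghm (x, y)).1
    simp_rw [fun x => hfg _ (hKI (hmem (x, y)))]
    rw [integral_add (hi.const_mul a) (integrable_const b), integral_const_mul]
    simp
  simp_rw [hfint, fun y => hfinv _ (hsec' y), fun y => hginv _ (hsec' y),
    fun x => hfg' _ (hsec x)]
  rw [integral_add (hout.1.const_mul a) (integrable_const b), integral_const_mul]
  simp only [integral_const, probReal_univ, one_smul]
  rw [hfinv _ hout.2, integral_integral_swap hprod]

/-- **Main Theorem.** Let `(X, ℒ, λ)` and `(Y, ℳ, μ)` be probability spaces with `λ`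
and `μ` non-degenerate, and let `f, g : I → ℝ` be continuous injections (`I ⊆ ℝ` a
nonempty interval).  Then `(f, g)` is a `(λ, μ)`-switch if and only if there exist
`a, b ∈ ℝ` with `a ≠ 0` such that `f = a·g + b` on `I`. -/
theorem isSwitch_iff_affine {X Y : Type*} [MeasurableSpace X] [MeasurableSpace Y]
    (lam : Measure X) (mu : Measure Y)
    [IsProbabilityMeasure lam] [IsProbabilityMeasure mu]
    (hlam : ∃ E, MeasurableSet E ∧ 0 < lam E ∧ lam E < 1)
    (hmu : ∃ F, MeasurableSet F ∧ 0 < mu F ∧ mu F < 1)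
    (I : Set ℝ) (hI : I.Nonempty) (hIconn : I.OrdConnected)
    (f g : ℝ → ℝ) (hfc : ContinuousOn f I) (hfi : Set.InjOn f I)
    (hgc : ContinuousOn g I) (hgi : Set.InjOn g I) :
    IsSwitch lam mu I f g ↔ ∃ a b : ℝ, a ≠ 0 ∧ ∀ x ∈ I, f x = a * g x + b := by
  constructor
  · intro hsw
    obtain ⟨E, hE, hE0, hE1⟩ := hlam
    obtain ⟨F, hF, hF0, hF1⟩ := hmu
    have three : ∀ A ∈ I, ∀ B ∈ I, ∀ x, A ≤ x → x ≤ B →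
        (f x - f A) * (g B - g A) = (g x - g A) * (f B - f A) :=
      fun A hA B hB x hAx hxB => hsw.collinear hE hF
        (ENNReal.toReal_pos hE0.ne' hE1.ne_top)
        (ENNReal.toReal_lt_of_lt_ofReal (by simpa using hE1))
        (ENNReal.toReal_pos hF0.ne' hF1.ne_top)
        (ENNReal.toReal_lt_of_lt_ofReal (by simpa using hF1))
        hIconn hfc hfi hgc hgi hA hB hAx hxB
    rcases I.subsingleton_or_nontrivial with hsub | hnon
    · obtain ⟨x₀, hx₀⟩ := hI
      refine ⟨1, f x₀ - g x₀, one_ne_zero, fun x hx => ?_⟩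
      rw [hsub hx hx₀]
      ring
    · obtain ⟨A, hA, B, hB, hAB⟩ := hnon.exists_lt
      have hf : f B - f A ≠ 0 := sub_ne_zero.mpr fun h => hAB.ne' (hfi hB hA h)
      have hg : g B - g A ≠ 0 := sub_ne_zero.mpr fun h => hAB.ne' (hgi hB hA h)
      refine ⟨(f B - f A) / (g B - g A), f A - (f B - f A) / (g B - g A) * g A,
        div_ne_zero hf hg, fun x hx => ?_⟩
      have key : (f x - f A) * (g B - g A) = (g x - g A) * (f B - f A) := by
        rcases le_total x A with hxA | hAx
        · linarith [three x hx B hB A hxA hAB.le]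
        · rcases le_total x B with hxB | hBx
          · exact three A hA B hB x hAx hxB
          · linarith [three A hA x hx B hAB.le hBx]
      field_simp
      linarith
  · rintro ⟨a, b, -, hfg⟩
    exact isSwitch_of_affine lam mu hIconn hgc hfi hfg
end
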